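/- For every natural number n, every conversion of the word w_n to the empty word by a sequence of free reductions, free expansions and applications of relators of Q contains an intermediate word of length at least 2ⁿ; that is, FL(w_n) ≥ 2ⁿ. -/

import Mathlib

/-! Words over an alphabet `A`: a letter `(x, true)` is the generator `x`,
and `(x, false)` is its formal inverse `x⁻¹`. -/

/-- A word over the alphabet `A ∪ A⁻¹`. -/
abbrev Word (A : Type*) := List (A × Bool)

namespace Word

/-- The formal inverse of a word. -/
def inv {A : Type*} (w : Word A) : Word A := (w.map fun p => (p.1, !p.2)).reverse

/-- `w'` is a cyclic conjugate (cyclic permutation) of `w`. -/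
def IsCyclicConj {A : Type*} (w w' : Word A) : Prop :=
  ∃ u v : Word A, w = u ++ v ∧ w' = v ++ u

end Word

/-- Moves (i)–(iii) on words with respect to a set `R` of relator words:
free reduction, free expansion, and application of a relator (replace a subword `u`
by `v` where some cyclic conjugate of `u * v⁻¹` lies in `R ∪ R⁻¹`). -/
inductive Move {A : Type*} (R : Set (Word A)) : Word A → Word A → Prop
  | freeReduce (u v : Word A) (x : A) (b : Bool) :
      Move R (u ++ (x, b) :: (x, !b) :: v) (u ++ v)
  | freeExpand (u v : Word A) (x : A) (b : Bool) :
      Move R (u ++ v) (u ++ (x, b) :: (x, !b) :: v)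
  | relator (p q u v z : Word A)
      (hz : Word.IsCyclicConj (u ++ Word.inv v) z) (hR : z ∈ R ∨ Word.inv z ∈ R) :
      Move R (p ++ u ++ q) (p ++ v ++ q)

/-- Moves (i)–(iv): moves (i)–(iii) together with cyclic conjugation. -/
inductive MoveC {A : Type*} (R : Set (Word A)) : Word A → Word A → Prop
  | of {w w' : Word A} : Move R w w' → MoveC R w w'
  | cyc {w w' : Word A} : Word.IsCyclicConj w w' → MoveC R w w'

/-- Moves (i)–(v) on finite sequences of words: one of the moves (i)–(iv) applied to
one word of the sequence, or fragmentation of one word `u ++ v` into `u` and `v`. -/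
inductive MoveF {A : Type*} (R : Set (Word A)) : List (Word A) → List (Word A) → Prop
  | of (l₁ l₂ : List (Word A)) {w w' : Word A} :
      MoveC R w w' → MoveF R (l₁ ++ w :: l₂) (l₁ ++ w' :: l₂)
  | frag (l₁ l₂ : List (Word A)) (u v : Word A) :
      MoveF R (l₁ ++ (u ++ v) :: l₂) (l₁ ++ u :: v :: l₂)

/-- A word is null-homotopic over the presentation with relator set `R` if it represents
the identity of the presented group, i.e. lies in the normal closure of the relators. -/
def NullHomotopic {A : Type*} (R : Set (Word A)) (w : Word A) : Prop :=
  FreeGroup.mk w ∈ Subgroup.normalClosure (FreeGroup.mk '' R)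

/-- `FLle R w L`: the word `w` can be converted to the empty word by moves (i)–(iii)
with every intermediate word of length at most `L`. -/
def FLle {A : Type*} (R : Set (Word A)) (w : Word A) (L : ℕ) : Prop :=
  ∃ (m : ℕ) (f : ℕ → Word A), f 0 = w ∧ f m = [] ∧
    (∀ i < m, Move R (f i) (f (i + 1))) ∧ ∀ i ≤ m, (f i).length ≤ L

/-- `FFLle R w L`: the word `w` can be converted to the empty word by moves (i)–(iv)
with every intermediate word of length at most `L`. -/
def FFLle {A : Type*} (R : Set (Word A)) (w : Word A) (L : ℕ) : Prop :=
  ∃ (m : ℕ) (f : ℕ → Word A), f 0 = w ∧ f m = [] ∧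
    (∀ i < m, MoveC R (f i) (f (i + 1))) ∧ ∀ i ≤ m, (f i).length ≤ L

/-- The total length of a finite sequence of words. -/
def totalLength {A : Type*} (l : List (Word A)) : ℕ := (l.map List.length).sum

/-- `FFFLle R w L`: the length-one sequence `(w)` can be converted to a sequence of empty
words by moves (i)–(v) with every intermediate sequence of total length at most `L`. -/
def FFFLle {A : Type*} (R : Set (Word A)) (w : Word A) (L : ℕ) : Prop :=
  ∃ (m : ℕ) (f : ℕ → List (Word A)), f 0 = [w] ∧ (∀ u ∈ f m, u = ([] : Word A)) ∧
    (∀ i < m, MoveF R (f i) (f (i + 1))) ∧ ∀ i ≤ m, totalLength (f i) ≤ L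

/-- An element `x` of the free group is a conjugate of a relator of `R` or of an inverse
of a relator. -/
def IsConjRelator {A : Type*} (R : Set (Word A)) (x : FreeGroup A) : Prop :=
  ∃ c ρ : FreeGroup A, (ρ ∈ FreeGroup.mk '' R ∨ ρ⁻¹ ∈ FreeGroup.mk '' R) ∧ x = c * ρ * c⁻¹

/-- `AreaLe R g N`: in the free group, `g` is a product of at most `N` conjugates
of elements of `R ∪ R⁻¹`. -/
def AreaLe {A : Type*} (R : Set (Word A)) (g : FreeGroup A) (N : ℕ) : Prop :=
  ∃ l : List (FreeGroup A), l.length ≤ N ∧ (∀ x ∈ l, IsConjRelator R x) ∧ l.prod = g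

/-- The number of occurrences in `w` of the letter `x` or its inverse. -/
def countLtr {A : Type*} [DecidableEq A] (x : A) (w : Word A) : ℕ :=
  (w.filter fun p => p.1 = x).length

/-- The filling length `FL(w)` of a null-homotopic word. -/
noncomputable def FLw {A : Type*} (R : Set (Word A)) (w : Word A) : ℕ :=
  sInf {L | FLle R w L}

/-- The free filling length `FFL(w)` of a null-homotopic word. -/
noncomputable def FFLw {A : Type*} (R : Set (Word A)) (w : Word A) : ℕ :=
  sInf {L | FFLle R w L}

/-- The fragmenting free filling length `FFFL(w)` of a null-homotopic word. -/
noncomputable def FFFLw {A : Type*} (R : Set (Word A)) (w : Word A) : ℕ :=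
  sInf {L | FFFLle R w L}

/-- The filling length function `FL : ℕ → ℕ` of the presentation with relators `R`. -/
noncomputable def FLfn {A : Type*} (R : Set (Word A)) (n : ℕ) : ℕ :=
  sSup (FLw R '' {w | NullHomotopic R w ∧ w.length ≤ n})

/-- The free filling length function `FFL : ℕ → ℕ`. -/
noncomputable def FFLfn {A : Type*} (R : Set (Word A)) (n : ℕ) : ℕ :=
  sSup (FFLw R '' {w | NullHomotopic R w ∧ w.length ≤ n})

/-- The fragmenting free filling length function `FFFL : ℕ → ℕ`. -/
noncomputable def FFFLfn {A : Type*} (R : Set (Word A)) (n : ℕ) : ℕ :=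
  sSup (FFFLw R '' {w | NullHomotopic R w ∧ w.length ≤ n})

/-! The presentation `Q = ⟨a, b, r, s, t | a^b a⁻², [t,a], [r,at], [r,s], [s,t]⟩`. -/

/-- The five generators of the presentation `Q`. -/
inductive QGen | a | b | r | s | t
deriving DecidableEq

/-- The five relators of `Q`: `b⁻¹aba⁻¹a⁻¹`, `t⁻¹a⁻¹ta`, `r⁻¹t⁻¹a⁻¹rat`,
`r⁻¹s⁻¹rs`, `s⁻¹t⁻¹st`. -/
def QRels : Set (Word QGen) :=
  { [(QGen.b, false), (QGen.a, true), (QGen.b, true), (QGen.a, false), (QGen.a, false)],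
    [(QGen.t, false), (QGen.a, false), (QGen.t, true), (QGen.a, true)],
    [(QGen.r, false), (QGen.t, false), (QGen.a, false), (QGen.r, true), (QGen.a, true),
      (QGen.t, true)],
    [(QGen.r, false), (QGen.s, false), (QGen.r, true), (QGen.s, true)],
    [(QGen.s, false), (QGen.t, false), (QGen.s, true), (QGen.t, true)] }

/-- The word `bⁿ`. -/
def bpow (n : ℕ) : Word QGen := List.replicate n (QGen.b, true)

/-- The word `b⁻ⁿ`. -/
def bpowInv (n : ℕ) : Word QGen := List.replicate n (QGen.b, false)

/-- The word `a^{-bⁿ} = b⁻ⁿ a⁻¹ bⁿ`. -/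
def aConjNeg (n : ℕ) : Word QGen := bpowInv n ++ [(QGen.a, false)] ++ bpow n

/-- The word `a^{bⁿ} = b⁻ⁿ a bⁿ`. -/
def aConjPos (n : ℕ) : Word QGen := bpowInv n ++ [(QGen.a, true)] ++ bpow n

/-- The word `a^{-bⁿ} r a^{bⁿ}`. -/
def gword (n : ℕ) : Word QGen := aConjNeg n ++ [(QGen.r, true)] ++ aConjPos n

/-- The word `w_n = [s, a^{-bⁿ} r a^{bⁿ}] = s⁻¹ (b⁻ⁿa⁻¹bⁿ r b⁻ⁿabⁿ)⁻¹ s (b⁻ⁿa⁻¹bⁿ r b⁻ⁿabⁿ)`. -/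
def wn (n : ℕ) : Word QGen :=
  [(QGen.s, false)] ++ Word.inv (gword n) ++ [(QGen.s, true)] ++ gword n

/-- The word `a^{-bⁿ} r a^{bⁿ} r a^{bⁿ} r⁻¹ a^{-bⁿ}`. -/
def g'word (n : ℕ) : Word QGen :=
  aConjNeg n ++ [(QGen.r, true)] ++ aConjPos n ++ [(QGen.r, true)] ++ aConjPos n ++
    [(QGen.r, false)] ++ aConjNeg n

/-- The word `w'_n = [s, a^{-bⁿ} r a^{bⁿ} r a^{bⁿ} r⁻¹ a^{-bⁿ}]`. -/
def w'n (n : ℕ) : Word QGen :=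
  [(QGen.s, false)] ++ Word.inv (g'word n) ++ [(QGen.s, true)] ++ g'word n

namespace Word

variable {A : Type*}

theorem inv_cons (l : A × Bool) (w : Word A) : inv (l :: w) = inv w ++ [(l.1, !l.2)] := by
  simp [inv]

theorem mem_inv {w : Word A} {l : A × Bool} : l ∈ inv w ↔ (l.1, !l.2) ∈ w := by
  obtain ⟨x, c⟩ := l
  cases c <;> simp [inv]

variable {S : Type*} (ρ : A → Equiv.Perm S)

/-- The permutation by which a letter acts when the generators act through `ρ`. -/
def letterAct (l : A × Bool) : Equiv.Perm S :=
  if l.2 then ρ l.1 else (ρ l.1).symm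

/-- The state reached from `σ` by reading `w` from left to right. -/
def run (σ : S) (w : Word A) : S :=
  w.foldl (fun τ l => letterAct ρ l τ) σ

@[simp]
theorem run_nil (σ : S) : run ρ σ [] = σ := rfl

@[simp]
theorem run_cons (σ : S) (l : A × Bool) (w : Word A) :
    run ρ σ (l :: w) = run ρ (letterAct ρ l σ) w := rfl

@[simp]
theorem run_append (σ : S) (u v : Word A) :
    run ρ σ (u ++ v) = run ρ (run ρ σ u) v := by
  simp [run]

theorem letterAct_not_letterAct (x : A) (c : Bool) (σ : S) :
    letterAct ρ (x, !c) (letterAct ρ (x, c) σ) = σ := by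
  cases c <;> simp [letterAct]

theorem run_run_inv (σ : S) (w : Word A) : run ρ (run ρ σ w) (inv w) = σ := by
  induction w generalizing σ with
  | nil => rfl
  | cons l w ih => simpa [inv_cons, ih] using letterAct_not_letterAct ρ l.1 l.2 σ

theorem run_inv_run (σ : S) (w : Word A) : run ρ (run ρ σ (inv w)) w = σ := by
  induction w generalizing σ with
  | nil => rfl
  | cons l w ih =>
    have h := letterAct_not_letterAct ρ l.1 (!l.2) (run ρ σ (inv w))
    rw [Bool.not_not] at h
    simp [inv_cons, h, ih]

/-- `w` fixes every state satisfying `P`, and its letters preserve `P`. -/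
structure FixesOn (P : S → Prop) (w : Word A) : Prop where
  letter_iff : ∀ l ∈ w, ∀ σ, P (letterAct ρ l σ) ↔ P σ
  run_eq : ∀ σ, P σ → run ρ σ w = σ

variable {ρ} {P : S → Prop}

theorem prop_run_iff {w : Word A} (h : ∀ l ∈ w, ∀ σ, P (letterAct ρ l σ) ↔ P σ) (σ : S) :
    P (run ρ σ w) ↔ P σ := by
  induction w generalizing σ with
  | nil => rfl
  | cons l w ih =>
    rw [run_cons, ih fun l' hl' => h l' (List.mem_cons_of_mem l hl'), h l List.mem_cons_self]

theorem FixesOn.rotate {c d : Word A} (h : FixesOn ρ P (c ++ d)) : FixesOn ρ P (d ++ c) where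
  letter_iff l hl := h.letter_iff l (by simpa [or_comm] using hl)
  run_eq σ hσ := by
    have hP : P (run ρ σ (inv c)) := by
      rw [← prop_run_iff (fun l hl => h.letter_iff l (List.mem_append_left d hl)), run_inv_run]
      exact hσ
    have hd := h.run_eq _ hP
    rw [run_append, run_inv_run] at hd
    rw [run_append, hd, run_inv_run]

theorem FixesOn.of_inv {w : Word A} (h : FixesOn ρ P (inv w)) : FixesOn ρ P w where
  letter_iff l hl σ := by
    obtain ⟨x, c⟩ := l
    have h' := h.letter_iff (x, !c) (mem_inv.2 (by simpa using hl)) (letterAct ρ (x, c) σ)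
    rw [letterAct_not_letterAct] at h'
    exact h'.symm
  run_eq σ hσ := by
    conv_lhs => rw [← h.run_eq σ hσ]
    exact run_inv_run ρ σ w

theorem FixesOn.run_eq_run {u v : Word A} (h : FixesOn ρ P (u ++ inv v)) {σ : S} (hσ : P σ) :
    run ρ σ u = run ρ σ v := by
  have huv := h.run_eq σ hσ
  rw [run_append] at huv
  rw [← run_inv_run ρ (run ρ σ u) v, huv]

end Word

/-- A move preserves the state reached from `σ₀` provided each relator fixes a family of states
that includes all those reached by reading fewer than `N` letters. -/
theorem Move.run_eq {A S : Type*} {R : Set (Word A)} {ρ : A → Equiv.Perm S} {σ₀ : S} {N : ℕ}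
    (hR : ∀ z ∈ R, ∃ P : S → Prop, Word.FixesOn ρ P z ∧
      ∀ p : Word A, p.length < N → P (Word.run ρ σ₀ p))
    {w w' : Word A} (h : Move R w w') (hw : w.length < N) :
    Word.run ρ σ₀ w = Word.run ρ σ₀ w' := by
  cases h with
  | freeReduce u v x c => simp [Word.letterAct_not_letterAct]
  | freeExpand u v x c => simp [Word.letterAct_not_letterAct]
  | relator p q u v z hz hzR =>
    obtain ⟨c, d, hcd, rfl⟩ := hz
    have hp : p.length < N := by
      simp only [List.length_append] at hw
      omega
    have key : ∃ P : S → Prop, Word.FixesOn ρ P (d ++ c) ∧ P (Word.run ρ σ₀ p) := by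
      rcases hzR with hz | hz
      · obtain ⟨P, hP, hN⟩ := hR _ hz
        exact ⟨P, hP, hN p hp⟩
      · obtain ⟨P, hP, hN⟩ := hR _ hz
        exact ⟨P, hP.of_inv, hN p hp⟩
    obtain ⟨P, hP, hσ⟩ := key
    have huv : Word.FixesOn ρ P (u ++ Word.inv v) := hcd ▸ hP.rotate
    simp [huv.run_eq_run hσ]

namespace QGen

/-- States of the action of the generators of `Q`: the generator `a` translates and `b` dilates
the first coordinate, `t` translates the second, `r` may flip the third and `s` counts in the
fourth. -/
abbrev State := ℚ × ℤ × Bool × ℤ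

/-- The action of the generators of `Q` on `State`. All relators but `[r, s]` act trivially, and
`[r, s]` fixes every state whose second coordinate differs from `N`. -/
def act (N : ℕ) : QGen → Equiv.Perm State
  | a => ⟨fun σ => (σ.1 + 1, σ.2), fun σ => (σ.1 - 1, σ.2),
      fun σ => by simp, fun σ => by simp⟩
  | b => ⟨fun σ => (2 * σ.1, σ.2), fun σ => (σ.1 / 2, σ.2),
      fun σ => by simp, fun σ => by simp [mul_div_cancel₀]⟩
  | r => ⟨fun σ => (σ.1, σ.2.1, σ.2.2.1 ^^ decide (σ.2.1 - ⌊σ.1⌋ = N), σ.2.2.2),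
      fun σ => (σ.1, σ.2.1, σ.2.2.1 ^^ decide (σ.2.1 - ⌊σ.1⌋ = N), σ.2.2.2),
      fun σ => by simp, fun σ => by simp⟩
  | s => ⟨fun σ => (σ.1, σ.2.1, σ.2.2.1, σ.2.2.2 + if σ.1 = 0 ∧ σ.2.2.1 then 1 else 0),
      fun σ => (σ.1, σ.2.1, σ.2.2.1, σ.2.2.2 - if σ.1 = 0 ∧ σ.2.2.1 then 1 else 0),
      fun σ => by simp, fun σ => by simp⟩
  | t => ⟨fun σ => (σ.1, σ.2.1 + 1, σ.2.2), fun σ => (σ.1, σ.2.1 - 1, σ.2.2),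
      fun σ => by simp, fun σ => by simp⟩

theorem run_act_height_le (N : ℕ) (w : Word QGen) (σ : State) :
    (Word.run (act N) σ w).2.1 ≤ σ.2.1 + w.length := by
  induction w generalizing σ with
  | nil => simp
  | cons l w ih =>
    have hl : (Word.letterAct (act N) l σ).2.1 ≤ σ.2.1 + 1 := by
      obtain ⟨x, c⟩ := l
      cases x <;> cases c <;> simp [Word.letterAct, act]
      omega
    have := ih (Word.letterAct (act N) l σ)
    simp only [Word.run_cons, List.length_cons, Nat.cast_add, Nat.cast_one]
    omega

theorem exists_fixesOn_of_mem_QRels (N : ℕ) {z : Word QGen} (hz : z ∈ QRels) :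
    ∃ P : State → Prop, Word.FixesOn (act N) P z ∧
      ∀ p : Word QGen, p.length < N → P (Word.run (act N) (0, 0, false, 0) p) := by
  simp only [QRels, Set.mem_insert_iff, Set.mem_singleton_iff] at hz
  rcases hz with rfl | rfl | rfl | rfl | rfl
  · refine ⟨fun _ => True, ⟨fun _ _ _ => Iff.rfl, fun σ _ => ?_⟩, fun _ _ => trivial⟩
    ext <;> simp [Word.letterAct, act]
    ring
  · refine ⟨fun _ => True, ⟨fun _ _ _ => Iff.rfl, fun σ _ => ?_⟩, fun _ _ => trivial⟩
    simp [Word.letterAct, act]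
  · refine ⟨fun _ => True, ⟨fun _ _ _ => Iff.rfl, fun σ _ => ?_⟩, fun _ _ => trivial⟩
    simp [Word.letterAct, act]
  · refine ⟨fun σ => σ.2.1 ≠ N, ⟨?_, fun σ hσ => ?_⟩, fun p hp => ?_⟩
    · intro l hl σ
      simp only [List.mem_cons, List.not_mem_nil, or_false] at hl
      rcases hl with rfl | rfl | rfl | rfl <;> simp [Word.letterAct, act]
    · by_cases h : σ.1 = 0
      · ext <;> simp [Word.letterAct, act, h, hσ]
      · simp [Word.letterAct, act, h]
    · have := run_act_height_le N p (0, 0, false, 0)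
      simp only [zero_add] at this
      omega
  · refine ⟨fun _ => True, ⟨fun _ _ _ => Iff.rfl, fun σ _ => ?_⟩, fun _ _ => trivial⟩
    simp [Word.letterAct, act]

theorem run_bpow (N n : ℕ) (σ : State) :
    Word.run (act N) σ (bpow n) = (2 ^ n * σ.1, σ.2) := by
  induction n generalizing σ with
  | zero => simp [bpow]
  | succ n ih =>
    rw [bpow, List.replicate_succ, Word.run_cons, ← bpow, ih]
    simp [Word.letterAct, act, pow_succ, mul_assoc]

theorem run_bpowInv (N n : ℕ) (σ : State) :
    Word.run (act N) σ (bpowInv n) = (σ.1 / 2 ^ n, σ.2) := by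
  induction n generalizing σ with
  | zero => simp [bpowInv]
  | succ n ih =>
    rw [bpowInv, List.replicate_succ, Word.run_cons, ← bpowInv, ih]
    simp [Word.letterAct, act, pow_succ', div_div]

theorem run_aConjPos (N n : ℕ) (σ : State) :
    Word.run (act N) σ (aConjPos n) = (σ.1 + 2 ^ n, σ.2) := by
  simp [aConjPos, run_bpow, run_bpowInv, Word.letterAct, act, mul_add, mul_div_cancel₀]

theorem run_aConjNeg (N n : ℕ) (σ : State) :
    Word.run (act N) σ (aConjNeg n) = (σ.1 - 2 ^ n, σ.2) := by
  simp [aConjNeg, run_bpow, run_bpowInv, Word.letterAct, act, mul_sub, mul_div_cancel₀]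

theorem inv_gword (n : ℕ) :
    Word.inv (gword n) = aConjNeg n ++ [(r, false)] ++ aConjPos n := by
  simp [gword, aConjPos, aConjNeg, bpow, bpowInv, Word.inv]

theorem run_wn (n : ℕ) :
    (Word.run (act (2 ^ n)) (0, 0, false, 0) (wn n)).2.2.2 = 1 := by
  have hfloor : ⌊(-2 ^ n : ℚ)⌋ = -2 ^ n := by
    exact_mod_cast Int.floor_intCast (R := ℚ) (-2 ^ n)
  rw [wn, inv_gword, gword]
  simp [run_aConjPos, run_aConjNeg, Word.letterAct, act, hfloor]

end QGen

theorem FL_wn_lower_bound (n m : ℕ) (f : ℕ → Word QGen)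
    (h0 : f 0 = wn n) (hm : f m = [])
    (hmove : ∀ i < m, Move QRels (f i) (f (i + 1))) :
    ∃ i ≤ m, 2 ^ n ≤ (f i).length := by
  by_contra! hlt
  have hrun : ∀ i ≤ m, Word.run (QGen.act (2 ^ n)) (0, 0, false, 0) (f i) =
      Word.run (QGen.act (2 ^ n)) (0, 0, false, 0) (wn n) := by
    intro i
    induction i with
    | zero => exact fun _ => by rw [h0]
    | succ i ih =>
      intro hi
      rw [← ih (by omega)]
      exact ((hmove i hi).run_eq (fun _ hz => QGen.exists_fixesOn_of_mem_QRels (2 ^ n) hz)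
        (hlt i (by omega))).symm
  have hz := QGen.run_wn n
  rw [← hrun m le_rfl, hm] at hz
  simp at hz
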